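/- Let X be a nonempty open convex subset of ℝⁿ and let g : X → ℝ be differentiable and quasiconcave. Then g is pseudoconcave on X if and only if for every x ∈ X with ∇g(x) = 0, g has a local maximum at x. -/

import Mathlib

open RealInnerProductSpace

/-- `g` is pseudoconcave on `X` (differentiable case). -/
def PseudoconcaveOn {n : ℕ} (X : Set (EuclideanSpace ℝ (Fin n)))
    (g : EuclideanSpace ℝ (Fin n) → ℝ) : Prop :=
  ∀ x₁ ∈ X, ∀ x₂ ∈ X, ⟪gradient g x₁, x₂ - x₁⟫ ≤ 0 → g x₂ ≤ g x₁

section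

variable {E : Type*} [NormedAddCommGroup E] [InnerProductSpace ℝ E] [CompleteSpace E]
  {X : Set E} {g : E → ℝ} {x y : E}

/-- At a point `x`, the gradient of a quasiconcave function makes a nonnegative inner product with
the direction to any point whose value is at least `g x`. -/
theorem QuasiconcaveOn.inner_gradient_nonneg (hqc : QuasiconcaveOn ℝ X g)
    (hd : DifferentiableAt ℝ g x) (hx : x ∈ X) (hy : y ∈ X) (hxy : g x ≤ g y) :
    0 ≤ ⟪gradient g x, y - x⟫ := by
  have hmin : IsLocalMinOn g (segment ℝ x y) x := by
    refine IsMinOn.localize fun z hz => ?_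
    exact ((hqc (g x)).segment_subset ⟨hx, le_rfl⟩ ⟨hy, hxy⟩ hz).2
  have h := hmin.hasFDerivWithinAt_nonneg
    hd.hasGradientAt.hasFDerivAt.hasFDerivWithinAt
    (sub_mem_posTangentConeAt_of_segment_subset subset_rfl)
  simpa using h

/-- The pseudoconcavity inequality holds at every noncritical point of a quasiconcave function. -/
theorem QuasiconcaveOn.le_of_inner_gradient_nonpos (hqc : QuasiconcaveOn ℝ X g)
    (hopen : IsOpen X) (hdx : DifferentiableAt ℝ g x) (hcy : ContinuousAt g y)
    (hx : x ∈ X) (hy : y ∈ X) (hgrad : gradient g x ≠ 0)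
    (hxy : ⟪gradient g x, y - x⟫ ≤ 0) : g y ≤ g x := by
  by_contra! hlt
  have hev : ∀ᶠ z in nhds y, z ∈ X ∧ g x < g z :=
    (hopen.eventually_mem hy).and (hcy.eventually_const_lt hlt)
  have htend : Filter.Tendsto (fun ε : ℝ => y - ε • gradient g x) (nhdsWithin 0 (Set.Ioi 0))
      (nhds y) := by
    have : Continuous fun ε : ℝ => y - ε • gradient g x := by fun_prop
    simpa using (this.tendsto 0).mono_left nhdsWithin_le_nhds
  obtain ⟨ε, ⟨hmem, hε⟩, hpos⟩ := ((htend.eventually hev).and self_mem_nhdsWithin).exists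
  have h := hqc.inner_gradient_nonneg hdx hx hmem hε.le
  rw [sub_right_comm, inner_sub_right, inner_smul_right] at h
  have := mul_pos (Set.mem_Ioi.mp hpos) (real_inner_self_pos.mpr hgrad)
  linarith

/-- A critical point of a quasiconcave function is a global maximum as soon as all critical points
are local maxima. -/
theorem QuasiconcaveOn.le_of_gradient_eq_zero (hqc : QuasiconcaveOn ℝ X g)
    (hopen : IsOpen X) (hconv : Convex ℝ X) (hdiff : ∀ x ∈ X, DifferentiableAt ℝ g x)
    (hmax : ∀ x ∈ X, gradient g x = 0 → IsLocalMaxOn g X x)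
    (hx : x ∈ X) (hy : y ∈ X) (hgrad : gradient g x = 0) : g y ≤ g x := by
  by_contra! hlt
  let p : ℝ → E := AffineMap.lineMap x y
  have hp : Continuous p := AffineMap.lineMap_continuous
  have hpX : Set.MapsTo p (Set.Icc 0 1) X := fun t ht => hconv.lineMap_mem hx hy ht
  have hcont : ContinuousOn (g ∘ p) (Set.Icc 0 1) := fun t ht =>
    ((hdiff _ (hpX ht)).continuousAt.comp hp.continuousAt).continuousWithinAt
  have hcompact : IsCompact (Set.Icc (0 : ℝ) 1 ∩ (g ∘ p) ⁻¹' Set.Iic (g x)) :=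
    isCompact_Icc.of_isClosed_subset
      (hcont.preimage_isClosed_of_isClosed isClosed_Icc isClosed_Iic) Set.inter_subset_left
  -- `p T` is the last point of the segment from `x` to `y` where `g` is at most `g x`.
  obtain ⟨T, ⟨hT, hgT⟩, hlast⟩ := hcompact.exists_isGreatest ⟨0, by simp [p]⟩
  replace hgT : g (p T) ≤ g x := hgT
  have hT1 : T < 1 := by
    refine lt_of_le_of_ne hT.2 fun h => ?_
    simp only [h, p, AffineMap.lineMap_apply_one] at hgT
    exact hgT.not_gt hlt
  have hz := hpX hT
  have hzero : gradient g (p T) = 0 := by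
    rcases hT.1.eq_or_lt with h0 | hpos
    · simpa [p, ← h0] using hgrad
    by_contra hne
    have h := hqc.inner_gradient_nonneg (hdiff _ hz) hz hx hgT
    have hxz : x - p T = (-T) • (y - x) := by
      simp [p, AffineMap.lineMap_apply_module']
    have hyz : y - p T = (1 - T) • (y - x) := by
      simp only [p, AffineMap.lineMap_apply_module']; module
    rw [hxz, inner_smul_right] at h
    have hle := hqc.le_of_inner_gradient_nonpos hopen (hdiff _ hz) (hdiff _ hy).continuousAt
      hz hy hne (by rw [hyz, inner_smul_right]; nlinarith)
    linarith
  have hloc : ∀ᶠ w in nhds (p T), g w ≤ g (p T) :=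
    (hmax _ hz hzero).isLocalMax (hopen.mem_nhds hz)
  have hright := (hp.continuousAt.eventually hloc).filter_mono
    (nhdsWithin_le_nhds (s := Set.Ioi T))
  obtain ⟨t, ht, htT⟩ := (hright.and (Ioo_mem_nhdsGT hT1)).exists
  exact htT.1.not_ge (hlast ⟨⟨hT.1.trans htT.1.le, htT.2.le⟩, ht.trans hgT⟩)

end

theorem stmt_4 {n : ℕ} (X : Set (EuclideanSpace ℝ (Fin n)))
    (g : EuclideanSpace ℝ (Fin n) → ℝ)
    (hne : X.Nonempty) (hopen : IsOpen X) (hconv : Convex ℝ X)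
    (hdiff : ∀ x ∈ X, DifferentiableAt ℝ g x)
    (hqc : QuasiconcaveOn ℝ X g) :
    PseudoconcaveOn X g ↔
      ∀ x ∈ X, gradient g x = 0 → IsLocalMaxOn g X x := by
  constructor
  · intro hpc x hx hgrad
    exact IsMaxOn.localize fun y hy => hpc x hx y hy (by simp [hgrad])
  · intro hmax x hx y hy hxy
    by_cases hgrad : gradient g x = 0
    · exact hqc.le_of_gradient_eq_zero hopen hconv hdiff hmax hx hy hgrad
    · exact hqc.le_of_inner_gradient_nonpos hopen (hdiff x hx) (hdiff y hy).continuousAt hx hy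
        hgrad hxy
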